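/- arXiv:1704.01996 — 10 statements merged into one kernel-verified Lean document; each statement's English description precedes it below -/
import Mathlib

section
/- Let B be a finite simple bipartite graph with partite sets X and Y (i.e., V(B) = X ∪ Y with X and Y disjoint and every edge of B joining a vertex of X to a vertex of Y). If a finite simple graph G is a minor of B, then OCT(G) ≤ min(|X|, |Y|). -/
/-- The minimum size of an odd cycle transversal: a set `S` of vertices such that the
induced subgraph on the complement of `S` is bipartite (2-colorable). -/
noncomputable def octNum {V : Type*} (G : SimpleGraph V) : ℕ :=
  sInf {k | ∃ S : Set V, S.ncard = k ∧ (G.induce (Sᶜ : Set V)).Colorable 2}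

/-- `G` is a minor of `H`: each vertex of `G` is assigned a nonempty set of vertices of `H`,
the sets are pairwise disjoint, each induces a connected subgraph of `H`, and every edge of
`G` is represented by an edge of `H` between the corresponding sets. -/
def IsMinor {V W : Type*} (G : SimpleGraph V) (H : SimpleGraph W) : Prop :=
  ∃ φ : V → Set W,
    (∀ u, (φ u).Nonempty) ∧
    (Pairwise fun u v => Disjoint (φ u) (φ v)) ∧
    (∀ u, (H.induce (φ u)).Connected) ∧
    (∀ u v, G.Adj u v → ∃ u' ∈ φ u, ∃ v' ∈ φ v, H.Adj u' v')

/-- If the sets `φ u` are pairwise disjoint and represent the edges of `G` by edges of `H`, then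
every vertex cover `C` of `H` bounds the odd cycle transversal number of `G`. -/
theorem octNum_le_ncard_of_cover {V W : Type*} [Finite W] (G : SimpleGraph V)
    (H : SimpleGraph W) (φ : V → Set W)
    (hφ : Pairwise fun u v => Disjoint (φ u) (φ v))
    (hadj : ∀ u v, G.Adj u v → ∃ u' ∈ φ u, ∃ v' ∈ φ v, H.Adj u' v')
    (C : Set W) (hC : ∀ u v, H.Adj u v → u ∈ C ∨ v ∈ C) :
    octNum G ≤ C.ncard := by
  let S : Set V := {u | ∃ w ∈ φ u, w ∈ C}
  have hcolor : (G.induce (Sᶜ : Set V)).Colorable 2 := by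
    refine ⟨SimpleGraph.Coloring.mk (fun _ => 0) ?_⟩
    rintro ⟨u, hu⟩ ⟨v, hv⟩ huv
    obtain ⟨u', hu', v', hv', h⟩ := hadj u v huv
    exact ((hC u' v' h).elim (fun h => hu ⟨u', hu', h⟩) fun h => hv ⟨v', hv', h⟩).elim
  have hcard : S.ncard ≤ C.ncard := by
    choose f hf hfC using fun u : S => u.2
    refine Nat.card_le_card_of_injective (fun u => (⟨f u, hfC u⟩ : C)) fun u v huv => ?_
    by_contra hne
    have huv : f u = f v := congrArg Subtype.val huv
    exact Set.disjoint_left.mp (hφ (Subtype.coe_injective.ne hne)) (hf u) (huv ▸ hf v)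
  have hoct : octNum G ≤ S.ncard := Nat.sInf_le ⟨S, rfl, hcolor⟩
  exact hoct.trans hcard

/-- If `B` is a finite bipartite graph with partite sets `X` and `Y` and the finite
graph `G` is a minor of `B`, then `OCT(G) ≤ min(|X|, |Y|)`. -/
theorem oct_le_of_minor_bipartite {VB VG : Type*} [Fintype VB] [Fintype VG]
    (B : SimpleGraph VB) (G : SimpleGraph VG) (X Y : Set VB)
    (hdisj : Disjoint X Y) (hcover : X ∪ Y = Set.univ)
    (hbip : ∀ u v, B.Adj u v → (u ∈ X ∧ v ∈ Y) ∨ (u ∈ Y ∧ v ∈ X))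
    (hminor : IsMinor G B) :
    octNum G ≤ min X.ncard Y.ncard := by
  obtain ⟨φ, -, hφ, -, hadj⟩ := hminor
  refine le_min (octNum_le_ncard_of_cover G B φ hφ hadj X fun u v h => ?_)
    (octNum_le_ncard_of_cover G B φ hφ hadj Y fun u v h => ?_)
  · exact (hbip u v h).imp And.left And.right
  · exact (hbip u v h).symm.imp And.left And.right
end

section
/- For all positive integers L, M, N, if a finite simple graph G is a minor of the Chimera graph C_{L,M,N}, then OCT(G) ≤ L·M·N. -/
/-- The Chimera graph `C_{L,M,N}`: an `M × N` grid of `K_{L,L}` cells.  A vertex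
`(r, c, p, h)` has row `r`, column `c`, partite index `p`, and in-cell height `h`.
Vertices are adjacent iff they are in the same cell with different partite indices
(intra-cell edges), or they are in partite set `0` with equal column and height and
adjacent rows (vertical inter-cell edges), or they are in partite set `1` with equal
row and height and adjacent columns (horizontal inter-cell edges). -/
def chimera (L M N : ℕ) : SimpleGraph (Fin M × Fin N × Fin 2 × Fin L) :=
  SimpleGraph.fromRel fun x y =>
    (x.1 = y.1 ∧ x.2.1 = y.2.1 ∧ x.2.2.1 ≠ y.2.2.1) ∨
    (x.2.2.1 = 0 ∧ y.2.2.1 = 0 ∧ x.2.1 = y.2.1 ∧ x.2.2.2 = y.2.2.2 ∧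
      ((x.1 : ℕ) + 1 = (y.1 : ℕ) ∨ (y.1 : ℕ) + 1 = (x.1 : ℕ))) ∨
    (x.2.2.1 = 1 ∧ y.2.2.1 = 1 ∧ x.1 = y.1 ∧ x.2.2.2 = y.2.2.2 ∧
      ((x.2.1 : ℕ) + 1 = (y.2.1 : ℕ) ∨ (y.2.1 : ℕ) + 1 = (x.2.1 : ℕ)))

/-- A pairwise disjoint family of sets, each meeting the partite set `1` of the Chimera
vertices, has at most `L * M * N` members. -/
lemma ncard_meeting_horizontal_le {V : Type*} {L M N : ℕ}
    (φ : V → Set (Fin M × Fin N × Fin 2 × Fin L))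
    (hdisj : Pairwise fun u v => Disjoint (φ u) (φ v)) :
    {u | ∃ x ∈ φ u, x.2.2.1 = 1}.ncard ≤ L * M * N := by
  have hS : ∀ u : {u | ∃ x ∈ φ u, x.2.2.1 = 1}, ∃ x ∈ φ u, x.2.2.1 = 1 := fun u => u.2
  choose g hg hg1 using hS
  have hinj : Function.Injective
      fun u => ((g u).1, (g u).2.1, (g u).2.2.2) := by
    intro u v huv
    simp only [Prod.mk.injEq] at huv
    have hguv : g u = g v :=
      Prod.ext huv.1 (Prod.ext huv.2.1 (Prod.ext ((hg1 u).trans (hg1 v).symm) huv.2.2))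
    by_contra hne
    exact Set.disjoint_left.mp (hdisj fun h => hne (Subtype.ext h)) (hg u) (hguv ▸ hg v)
  have hcard := Nat.card_le_card_of_injective _ hinj
  rw [← Nat.card_coe_set_eq]
  refine hcard.trans (le_of_eq ?_)
  simp only [Nat.card_prod, Nat.card_fin]
  ring

/-- Adjacent Chimera vertices of partite set `0` lie in consecutive rows of one line. -/
lemma chimera_adj_vertical {L M N : ℕ} {x y : Fin M × Fin N × Fin 2 × Fin L}
    (h : (chimera L M N).Adj x y) (hx : x.2.2.1 = 0) (hy : y.2.2.1 = 0) :
    x.2 = y.2 ∧ ((x.1 : ℕ) + 1 = y.1 ∨ (y.1 : ℕ) + 1 = x.1) := by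
  obtain ⟨r, c, p, k⟩ := x
  obtain ⟨r', c', p', k'⟩ := y
  simp only [chimera, SimpleGraph.fromRel_adj] at h
  simp only at hx hy
  subst hx hy
  simp only [Prod.mk.injEq]
  simp at h
  tauto

open Classical in
/-- The number of `j < r` such that the vertices in rows `j` and `j + 1` of the line `l`
do not belong to a common member of the family `φ`. -/
noncomputable def boundaryCount {V α : Type*} {M : ℕ} (φ : V → Set (Fin M × α)) (l : α)
    (r : ℕ) : ℕ :=
  ((Finset.range r).filter fun j =>
    ¬ ∃ u, ∃ x ∈ φ u, ∃ y ∈ φ u, x.2 = l ∧ y.2 = l ∧ (x.1 : ℕ) = j ∧ (y.1 : ℕ) = j + 1).card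

lemma boundaryCount_eq_of_mem {V α : Type*} {M : ℕ} {φ : V → Set (Fin M × α)} {u : V}
    {x y : Fin M × α} (hx : x ∈ φ u) (hy : y ∈ φ u) (hl : x.2 = y.2)
    (hr : (x.1 : ℕ) + 1 = y.1) :
    boundaryCount φ y.2 y.1 = boundaryCount φ x.2 x.1 := by
  classical
  rw [← hl, ← hr, boundaryCount, boundaryCount, Finset.range_add_one, Finset.filter_insert,
    if_neg (not_not.mpr ⟨u, x, hx, y, hy, rfl, hl.symm, rfl, hr.symm⟩)]

lemma boundaryCount_eq_add_one {V α : Type*} {M : ℕ} {φ : V → Set (Fin M × α)}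
    (hdisj : Pairwise fun u v => Disjoint (φ u) (φ v)) {u v : V} (huv : u ≠ v)
    {x y : Fin M × α} (hx : x ∈ φ u) (hy : y ∈ φ v) (hl : x.2 = y.2)
    (hr : (x.1 : ℕ) + 1 = y.1) :
    boundaryCount φ y.2 y.1 = boundaryCount φ x.2 x.1 + 1 := by
  classical
  have key : ¬ ∃ w, ∃ a ∈ φ w, ∃ b ∈ φ w,
      a.2 = x.2 ∧ b.2 = x.2 ∧ (a.1 : ℕ) = x.1 ∧ (b.1 : ℕ) = x.1 + 1 := by
    rintro ⟨w, a, ha, b, hb, ha2, hb2, ha1, hb1⟩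
    obtain rfl : a = x := Prod.ext (Fin.ext ha1) ha2
    obtain rfl : b = y := Prod.ext (Fin.ext (hb1.trans hr)) (hb2.trans hl)
    have hwu : w = u := by
      by_contra h
      exact Set.disjoint_left.mp (hdisj h) ha hx
    have hwv : w = v := by
      by_contra h
      exact Set.disjoint_left.mp (hdisj h) hb hy
    exact huv (hwu.symm.trans hwv)
  rw [← hl, ← hr, boundaryCount, boundaryCount, Finset.range_add_one, Finset.filter_insert,
    if_pos key, Finset.card_insert_of_notMem (by simp)]

/-- A function on the vertices of a connected graph that agrees on adjacent vertices is
constant. -/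
lemma SimpleGraph.Connected.eq_of_forall_adj {W β : Type*} {H : SimpleGraph W}
    (hH : H.Connected) {f : W → β} (hf : ∀ x y, H.Adj x y → f x = f y) (x y : W) :
    f x = f y := by
  obtain ⟨p⟩ := hH.preconnected x y
  induction p with
  | nil => rfl
  | cons h _ ih => exact (hf _ _ h).trans ih

/-- If a finite graph `G` is a minor of the Chimera graph `C_{L,M,N}`,
then `OCT(G) ≤ L·M·N`. -/
theorem oct_le_of_minor_chimera {V : Type*} [Fintype V]
    (L M N : ℕ) (hL : 0 < L) (hM : 0 < M) (hN : 0 < N)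
    (G : SimpleGraph V) (hminor : IsMinor G (chimera L M N)) :
    octNum G ≤ L * M * N := by
  obtain ⟨φ, hne, hdisj, hconn, hadj⟩ := hminor
  refine le_trans (Nat.sInf_le ⟨{u | ∃ x ∈ φ u, x.2.2.1 = 1}, rfl, ?_⟩)
    (ncard_meeting_horizontal_le φ hdisj)
  have hvert : ∀ u ∈ {u | ∃ x ∈ φ u, x.2.2.1 = 1}ᶜ, ∀ x ∈ φ u, x.2.2.1 = 0 := by
    intro u hu x hx
    by_contra h
    exact hu ⟨x, hx, by omega⟩
  have hconst : ∀ u ∈ {u | ∃ x ∈ φ u, x.2.2.1 = 1}ᶜ, ∀ x ∈ φ u, ∀ y ∈ φ u,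
      boundaryCount φ x.2 x.1 = boundaryCount φ y.2 y.1 := by
    intro u hu x hx y hy
    refine (hconn u).eq_of_forall_adj (f := fun z => boundaryCount φ z.1.2 z.1.1) ?_
      ⟨x, hx⟩ ⟨y, hy⟩
    intro a b hab
    obtain ⟨hl, hr | hr⟩ := chimera_adj_vertical hab (hvert u hu _ a.2) (hvert u hu _ b.2)
    · exact (boundaryCount_eq_of_mem a.2 b.2 hl hr).symm
    · exact boundaryCount_eq_of_mem b.2 a.2 hl.symm hr
  choose g hg using hne
  refine ⟨SimpleGraph.Coloring.mk
    (fun u => (⟨boundaryCount φ (g u).2 (g u).1 % 2, Nat.mod_lt _ two_pos⟩ : Fin 2)) ?_⟩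
  intro u v huv heq
  have huv' : G.Adj u v := huv
  obtain ⟨x, hx, y, hy, hxy⟩ := hadj u v huv'
  simp only [Fin.mk.injEq] at heq
  rw [hconst u u.2 _ (hg u) x hx, hconst v v.2 _ (hg v) y hy] at heq
  obtain ⟨hl, hr | hr⟩ := chimera_adj_vertical hxy (hvert u u.2 x hx) (hvert v v.2 y hy)
  · have := boundaryCount_eq_add_one hdisj huv'.ne hx hy hl hr
    omega
  · have := boundaryCount_eq_add_one hdisj huv'.ne' hy hx hl.symm hr
    omega
end

section
/- For all positive integers L, M, N, there exists a finite simple graph G that is a minor of the Chimera graph C_{L,M,N} and satisfies OCT(G) ≥ (L−1)·M·N. -/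
/-- If any two distinct vertices with the same label are adjacent, then every odd cycle
transversal misses at most two vertices of each label. -/
theorem card_le_octNum_add {V ι : Type*} [Fintype V] [Fintype ι] (G : SimpleGraph V)
    (f : V → ι) (hG : ∀ u v, u ≠ v → f u = f v → G.Adj u v) :
    Fintype.card V ≤ octNum G + Fintype.card ι * 2 := by
  classical
  have hne : {k | ∃ S : Set V, S.ncard = k ∧ (G.induce (Sᶜ : Set V)).Colorable 2}.Nonempty :=
    ⟨_, Set.univ, rfl, ⟨SimpleGraph.Coloring.mk (fun _ => 0)
      fun {v} _ _ => absurd (Set.mem_univ v.1) v.2⟩⟩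
  obtain ⟨S, hS, ⟨C⟩⟩ := Nat.sInf_mem hne
  have hinj : Function.Injective fun v : (Sᶜ : Set V) => (f v, C v) := by
    intro u v huv
    by_contra hne
    obtain ⟨hf, hC⟩ := Prod.mk.inj huv
    exact C.valid (v := u) (w := v)
      (hG u v (fun h => hne (Subtype.ext h)) hf) hC
  have hcompl : (Sᶜ : Set V).ncard ≤ Fintype.card ι * 2 := by
    have h := Nat.card_le_card_of_injective _ hinj
    rw [Nat.card_coe_set_eq] at h
    simpa only [Nat.card_eq_fintype_card, Fintype.card_prod, Fintype.card_fin] using h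
  have htotal := Set.ncard_add_ncard_compl S
  rw [Nat.card_eq_fintype_card] at htotal
  change S.ncard = octNum G at hS
  omega

/-- Vertices of opposite partite index in the same cell are adjacent. -/
theorem chimera_adj_cell {L M N : ℕ} (r : Fin M) (c : Fin N) (h k : Fin L) :
    (chimera L M N).Adj (r, c, 0, h) (r, c, 1, k) := by
  simp [chimera]

/-- The branch sets of a `K_{L+1}` minor of the cell in row `r` and column `c`: two vertices of
the cell are contracted when the first has partite index `0` and height `k`, and the second has
partite index `1` and height `k - 1`. -/
def cellBranchSet {L M N : ℕ} (r : Fin M) (c : Fin N) (k : Fin (L + 1)) :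
    Set (Fin M × Fin N × Fin 2 × Fin L) :=
  {x | x.1 = r ∧ x.2.1 = c ∧ (x.2.2.2 : ℕ) + (x.2.2.1 : ℕ) = k}

theorem mk_zero_mem_cellBranchSet {L M N : ℕ} (r : Fin M) (c : Fin N) (k : Fin (L + 1))
    (h : Fin L) (hk : (h : ℕ) = k) : (r, c, 0, h) ∈ cellBranchSet r c k := by
  simp [cellBranchSet, hk]

theorem mk_one_mem_cellBranchSet {L M N : ℕ} (r : Fin M) (c : Fin N) (k : Fin (L + 1))
    (h : Fin L) (hk : (h : ℕ) + 1 = k) : (r, c, 1, h) ∈ cellBranchSet r c k := by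
  simp [cellBranchSet, hk]

theorem cellBranchSet_nonempty {L M N : ℕ} (hL : 0 < L) (r : Fin M) (c : Fin N)
    (k : Fin (L + 1)) : (cellBranchSet r c k).Nonempty := by
  by_cases hk : (k : ℕ) < L
  · exact ⟨_, mk_zero_mem_cellBranchSet r c k ⟨k, hk⟩ rfl⟩
  · exact ⟨_, mk_one_mem_cellBranchSet r c k ⟨k - 1, by omega⟩
      (Nat.sub_add_cancel (by omega))⟩

theorem chimera_adj_of_mem_cellBranchSet {L M N : ℕ} {r : Fin M} {c : Fin N} {k : Fin (L + 1)}
    {x y : Fin M × Fin N × Fin 2 × Fin L} (hx : x ∈ cellBranchSet r c k)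
    (hy : y ∈ cellBranchSet r c k) (hxy : x ≠ y) : (chimera L M N).Adj x y := by
  obtain ⟨r₁, c₁, p₁, h₁⟩ := x
  obtain ⟨r₂, c₂, p₂, h₂⟩ := y
  obtain ⟨rfl, rfl, hx⟩ := hx
  obtain ⟨rfl, rfl, hy⟩ := hy
  have hp : p₁ ≠ p₂ := by
    rintro rfl
    refine hxy ?_
    have : h₁ = h₂ := Fin.ext (by simp only at hx hy; omega)
    rw [this]
  exact (SimpleGraph.fromRel_adj _ _ _).2 ⟨hxy, Or.inl (Or.inl ⟨rfl, rfl, hp⟩)⟩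

theorem cellBranchSet_connected {L M N : ℕ} (hL : 0 < L) (r : Fin M) (c : Fin N)
    (k : Fin (L + 1)) : ((chimera L M N).induce (cellBranchSet r c k)).Connected := by
  have := (cellBranchSet_nonempty hL r c k).to_subtype
  refine SimpleGraph.Connected.mk fun x y => ?_
  by_cases hxy : x = y
  · exact hxy ▸ SimpleGraph.Reachable.refl x
  · exact SimpleGraph.Adj.reachable (G := (chimera L M N).induce (cellBranchSet r c k))
      (chimera_adj_of_mem_cellBranchSet x.2 y.2 fun h => hxy (Subtype.ext h))

theorem exists_chimera_adj_cellBranchSet_of_lt {L M N : ℕ} (r : Fin M) (c : Fin N)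
    {k l : Fin (L + 1)} (hkl : k < l) :
    ∃ x ∈ cellBranchSet r c k, ∃ y ∈ cellBranchSet r c l, (chimera L M N).Adj x y :=
  ⟨_, mk_zero_mem_cellBranchSet r c k ⟨k, by omega⟩ rfl,
    _, mk_one_mem_cellBranchSet r c l ⟨l - 1, by omega⟩ (Nat.sub_add_cancel (by omega)),
    chimera_adj_cell r c _ _⟩

theorem exists_chimera_adj_cellBranchSet {L M N : ℕ} (r : Fin M) (c : Fin N)
    {k l : Fin (L + 1)} (hkl : k ≠ l) :
    ∃ x ∈ cellBranchSet r c k, ∃ y ∈ cellBranchSet r c l, (chimera L M N).Adj x y := by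
  rcases hkl.lt_or_gt with h | h
  · exact exists_chimera_adj_cellBranchSet_of_lt r c h
  · obtain ⟨x, hx, y, hy, hxy⟩ := exists_chimera_adj_cellBranchSet_of_lt (M := M) r c h
    exact ⟨y, hy, x, hx, hxy.symm⟩

/-- There exists a finite graph `G` that is a minor of the Chimera graph `C_{L,M,N}`
with `OCT(G) ≥ (L−1)·M·N`. -/
theorem exists_chimera_minor_with_large_oct
    (L M N : ℕ) (hL : 0 < L) (hM : 0 < M) (hN : 0 < N) :
    ∃ (n : ℕ) (G : SimpleGraph (Fin n)),
      IsMinor G (chimera L M N) ∧ (L - 1) * M * N ≤ octNum G := by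
  let e := (Fintype.equivFin ((Fin M × Fin N) × Fin (L + 1))).symm
  refine ⟨_, SimpleGraph.fromRel fun u v => (e u).1 = (e v).1,
    ⟨fun u => cellBranchSet (e u).1.1 (e u).1.2 (e u).2,
      fun u => cellBranchSet_nonempty hL _ _ _, ?_,
      fun u => cellBranchSet_connected hL _ _ _, ?_⟩, ?_⟩
  · intro u v huv
    refine Set.disjoint_left.2 fun x hu hv => huv (e.injective ?_)
    exact Prod.ext (Prod.ext (hu.1.symm.trans hv.1) (hu.2.1.symm.trans hv.2.1))
      (Fin.ext (hu.2.2.symm.trans hv.2.2))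
  · intro u v huv
    obtain ⟨hne, h⟩ := (SimpleGraph.fromRel_adj _ _ _).1 huv
    have hcell : (e u).1 = (e v).1 := h.elim id Eq.symm
    have hk : (e u).2 ≠ (e v).2 := fun h => hne (e.injective (Prod.ext hcell h))
    simp only [← hcell]
    exact exists_chimera_adj_cellBranchSet _ _ hk
  · have h := card_le_octNum_add (SimpleGraph.fromRel fun u v => (e u).1 = (e v).1)
      (fun u => (e u).1) fun u v hne h => (SimpleGraph.fromRel_adj _ _ _).2 ⟨hne, Or.inl h⟩
    simp only [Fintype.card_fin, Fintype.card_prod] at h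
    obtain ⟨l, rfl⟩ := Nat.exists_eq_add_of_lt hL
    simp only [Nat.zero_add, Nat.add_sub_cancel] at h ⊢
    nlinarith [h]
end

section
/- For every positive integer n, the complete graph K_{n+1} is a minor of the complete bipartite graph K_{n,n}. -/
/-- A graph with a vertex adjacent to every other vertex is connected. -/
theorem SimpleGraph.connected_of_forall_eq_or_adj {V : Type*} {G : SimpleGraph V} (v : V)
    (h : ∀ w, w = v ∨ G.Adj v w) : G.Connected := by
  refine SimpleGraph.connected_iff_exists_forall_reachable G |>.2 ⟨v, fun w => ?_⟩
  obtain rfl | hw := h w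
  · exact SimpleGraph.Reachable.refl _
  · exact hw.reachable

/-- The map sending each vertex of `K_{m+1,m+1}` to the vertex of `K_{m+2}` it represents: the
`i`-th vertices of both sides represent `i`, except that the last vertex of the right-hand side
represents the last vertex of `K_{m+2}`. -/
def bipartiteMinorLabel (m : ℕ) : Fin (m + 1) ⊕ Fin (m + 1) → Fin (m + 2)
  | .inl i => i.castSucc
  | .inr i => if i = Fin.last m then Fin.last (m + 1) else i.castSucc

theorem bipartiteMinorLabel_inl {m : ℕ} (i : Fin (m + 1)) :
    bipartiteMinorLabel m (.inl i) = i.castSucc := rfl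

theorem bipartiteMinorLabel_inr_last (m : ℕ) :
    bipartiteMinorLabel m (.inr (Fin.last m)) = Fin.last (m + 1) := if_pos rfl

theorem bipartiteMinorLabel_inr_of_ne_last {m : ℕ} {i : Fin (m + 1)} (hi : i ≠ Fin.last m) :
    bipartiteMinorLabel m (.inr i) = i.castSucc := if_neg hi

theorem connected_induce_bipartiteMinorLabel_fiber {m : ℕ} (u : Fin (m + 2)) :
    ((completeBipartiteGraph (Fin (m + 1)) (Fin (m + 1))).induce
      {x | bipartiteMinorLabel m x = u}).Connected := by
  induction u using Fin.lastCases with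
  | last =>
    refine SimpleGraph.connected_of_forall_eq_or_adj
      ⟨.inr (Fin.last m), bipartiteMinorLabel_inr_last m⟩ ?_
    rintro ⟨i | i, hi⟩
    · exact absurd hi (Fin.castSucc_ne_last i)
    · by_cases h : i = Fin.last m
      · exact .inl (by simp [h])
      · rw [Set.mem_ofPred_eq, bipartiteMinorLabel_inr_of_ne_last h] at hi
        exact absurd hi (Fin.castSucc_ne_last i)
  | cast i =>
    refine SimpleGraph.connected_of_forall_eq_or_adj ⟨.inl i, bipartiteMinorLabel_inl i⟩ ?_
    rintro ⟨j | j, hj⟩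
    · exact .inl (by simpa using Fin.castSucc_injective _ hj)
    · exact .inr (by simp)

/-- For every positive integer `n`, the complete graph `K_{n+1}` is a minor of the
complete bipartite graph `K_{n,n}`. -/
theorem completeGraph_succ_isMinor_completeBipartite (n : ℕ) (hn : 0 < n) :
    IsMinor (⊤ : SimpleGraph (Fin (n + 1))) (completeBipartiteGraph (Fin n) (Fin n)) := by
  obtain ⟨m, rfl⟩ := Nat.exists_eq_add_of_lt hn
  rw [zero_add]
  refine ⟨fun u => {x | bipartiteMinorLabel m x = u}, fun u => ?_, fun u v huv => ?_,
    connected_induce_bipartiteMinorLabel_fiber, fun u v huv => ?_⟩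
  · exact Set.nonempty_coe_sort.1 (connected_induce_bipartiteMinorLabel_fiber u).nonempty
  · exact Set.disjoint_left.2 fun x hu hv => huv (hu.symm.trans hv)
  · rw [SimpleGraph.top_adj] at huv
    induction u using Fin.lastCases with
    | last =>
      induction v using Fin.lastCases with
      | last => exact absurd rfl huv
      | cast j =>
        exact ⟨_, bipartiteMinorLabel_inr_last m, _, bipartiteMinorLabel_inl j, by simp⟩
    | cast i =>
      induction v using Fin.lastCases with
      | last =>
        exact ⟨_, bipartiteMinorLabel_inl i, _, bipartiteMinorLabel_inr_last m, by simp⟩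
      | cast j =>
        by_cases hj : j = Fin.last m
        · have hi : i ≠ Fin.last m := fun hi => huv (by rw [hi, hj])
          exact ⟨_, bipartiteMinorLabel_inr_of_ne_last hi, _, bipartiteMinorLabel_inl j, by simp⟩
        · exact ⟨_, bipartiteMinorLabel_inl i, _, bipartiteMinorLabel_inr_of_ne_last hj, by simp⟩
end

section
/- For all positive integers L, M, N, the complete bipartite graph K_{LM, LN} is a minor of the Chimera graph C_{L,M,N}. -/
theorem induce_range_connected {V W : Type*} {G : SimpleGraph V} {H : SimpleGraph W}
    (hG : G.Connected) (f : G →g H) : (H.induce (Set.range f)).Connected :=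
  hG.map (⟨Set.rangeFactorization f, fun h => f.map_rel h⟩ : G →g H.induce (Set.range f))
    Set.rangeFactorization_surjective

/-- The horizontal path of `chimera L M N` at a given height and row. -/
def chimeraRow {L M : ℕ} (N : ℕ) (p : Fin L × Fin M) :
    SimpleGraph.pathGraph N →g chimera L M N where
  toFun c := (p.2, c, 1, p.1)
  map_rel' {a b} h := by
    have hab := h.ne
    rw [SimpleGraph.pathGraph_adj] at h
    simp [chimera, hab, h]

/-- The vertical path of `chimera L M N` at a given height and column. -/
def chimeraColumn {L N : ℕ} (M : ℕ) (p : Fin L × Fin N) :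
    SimpleGraph.pathGraph M →g chimera L M N where
  toFun r := (r, p.2, 0, p.1)
  map_rel' {a b} h := by
    have hab := h.ne
    rw [SimpleGraph.pathGraph_adj] at h
    simp [chimera, hab, h]

@[simp]
theorem chimeraRow_apply {L M N : ℕ} (p : Fin L × Fin M) (c : Fin N) :
    chimeraRow N p c = (p.2, c, 1, p.1) := rfl

@[simp]
theorem chimeraColumn_apply {L M N : ℕ} (p : Fin L × Fin N) (r : Fin M) :
    chimeraColumn M p r = (r, p.2, 0, p.1) := rfl

theorem pathGraph_connected_of_pos {n : ℕ} (hn : 0 < n) : (SimpleGraph.pathGraph n).Connected := by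
  obtain ⟨k, rfl⟩ := Nat.exists_eq_succ_of_ne_zero hn.ne'
  exact SimpleGraph.pathGraph_connected k

theorem chimeraRow_adj_chimeraColumn {L M N : ℕ} (p : Fin L × Fin M) (q : Fin L × Fin N) :
    (chimera L M N).Adj (chimeraRow N p q.2) (chimeraColumn M q p.2) := by
  rw [chimeraRow_apply, chimeraColumn_apply]
  simp [chimera]

/-- For all positive integers `L, M, N`, the complete bipartite graph `K_{LM,LN}` is a
minor of the Chimera graph `C_{L,M,N}`. -/
theorem completeBipartite_isMinor_chimera (L M N : ℕ) (hL : 0 < L) (hM : 0 < M) (hN : 0 < N) :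
    IsMinor (completeBipartiteGraph (Fin (L * M)) (Fin (L * N))) (chimera L M N) := by
  refine ⟨Sum.elim (fun i => Set.range (chimeraRow N (finProdFinEquiv.symm i)))
    (fun j => Set.range (chimeraColumn M (finProdFinEquiv.symm j))), ?_, ?_, ?_, ?_⟩
  · rintro (i | j)
    · exact ⟨_, ⟨0, hN⟩, rfl⟩
    · exact ⟨_, ⟨0, hM⟩, rfl⟩
  · rintro (i | i) (j | j) hij <;> refine Set.disjoint_left.2 ?_ <;> rintro _ ⟨a, rfl⟩ ⟨b, hb⟩
    · refine hij (congrArg Sum.inl (finProdFinEquiv.symm.injective ?_))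
      simp only [chimeraRow_apply, Prod.mk.injEq] at hb
      exact Prod.ext hb.2.2.2.symm hb.1.symm
    · simp at hb
    · simp at hb
    · refine hij (congrArg Sum.inr (finProdFinEquiv.symm.injective ?_))
      simp only [chimeraColumn_apply, Prod.mk.injEq] at hb
      exact Prod.ext hb.2.2.2.symm hb.2.1.symm
  · rintro (i | j)
    · exact induce_range_connected (pathGraph_connected_of_pos hN) _
    · exact induce_range_connected (pathGraph_connected_of_pos hM) _
  · rintro (i | i) (j | j) h
    · simp at h
    · exact ⟨_, ⟨_, rfl⟩, _, ⟨_, rfl⟩, chimeraRow_adj_chimeraColumn _ _⟩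
    · exact ⟨_, ⟨_, rfl⟩, _, ⟨_, rfl⟩, (chimeraRow_adj_chimeraColumn _ _).symm⟩
    · simp at h
end

section
/- For all positive integers L, M, N, the complete graph K_{L·min(M,N)} is a minor of the Chimera graph C_{L,M,N}. -/
/-- The vertical line of the Chimera graph at column `c` and height `h`. -/
def chimeraVerticalHom {L M N : ℕ} (c : Fin N) (h : Fin L) :
    SimpleGraph.pathGraph M →g chimera L M N where
  toFun r := (r, c, 0, h)
  map_rel' {a b} hab := by
    have hne : a ≠ b := hab.ne
    rw [SimpleGraph.pathGraph_adj] at hab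
    simp [chimera, hne, hab]

/-- The horizontal line of the Chimera graph at row `r` and height `h`. -/
def chimeraHorizontalHom {L M N : ℕ} (r : Fin M) (h : Fin L) :
    SimpleGraph.pathGraph N →g chimera L M N where
  toFun c := (r, c, 1, h)
  map_rel' {a b} hab := by
    have hne : a ≠ b := hab.ne
    rw [SimpleGraph.pathGraph_adj] at hab
    simp [chimera, hne, hab]

@[simp]
theorem chimeraVerticalHom_apply {L M N : ℕ} (c : Fin N) (h : Fin L) (r : Fin M) :
    chimeraVerticalHom c h r = (r, c, 0, h) := rfl

@[simp]
theorem chimeraHorizontalHom_apply {L M N : ℕ} (r : Fin M) (h : Fin L) (c : Fin N) :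
    chimeraHorizontalHom r h c = (r, c, 1, h) := rfl

/-- The cross formed by the vertical line at column `c` and the horizontal line at row `r`,
both at height `h`. -/
def chimeraCross {L M N : ℕ} (r : Fin M) (c : Fin N) (h : Fin L) :
    Set (Fin M × Fin N × Fin 2 × Fin L) :=
  Set.range (chimeraVerticalHom c h) ∪ Set.range (chimeraHorizontalHom r h)

/-- The image of a preconnected graph under a homomorphism induces a preconnected subgraph. -/
theorem SimpleGraph.Preconnected.induce_range {V W : Type*} {G : SimpleGraph V}
    {H : SimpleGraph W} (hG : G.Preconnected) (f : G →g H) :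
    (H.induce (Set.range f)).Preconnected := by
  rintro ⟨_, a, rfl⟩ ⟨_, b, rfl⟩
  let g : G →g H.induce (Set.range f) :=
    { toFun := fun v => ⟨f v, v, rfl⟩
      map_rel' := fun hab => f.map_adj hab }
  exact (hG a b).map g

theorem chimeraCross_connected {L M N : ℕ} (r : Fin M) (c : Fin N) (h : Fin L) :
    ((chimera L M N).induce (chimeraCross r c h)).Connected :=
  SimpleGraph.connected_induce_union
    ((SimpleGraph.pathGraph_preconnected M).induce_range _)
    ((SimpleGraph.pathGraph_preconnected N).induce_range _)
    (Set.mem_range_self r) (Set.mem_range_self c) (chimera_adj_cell r c h h)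

theorem chimeraCross_disjoint {L M N : ℕ} {r r' : Fin M} {c c' : Fin N} {h h' : Fin L}
    (hr : (r, h) ≠ (r', h')) (hc : (c, h) ≠ (c', h')) :
    Disjoint (chimeraCross r c h) (chimeraCross r' c' h') := by
  rw [Set.disjoint_left]
  rintro _ (⟨a, rfl⟩ | ⟨a, rfl⟩) (⟨b, hb⟩ | ⟨b, hb⟩) <;>
    simp_all

/-- For all positive integers `L, M, N`, the complete graph `K_{L·min(M,N)}` is a minor
of the Chimera graph `C_{L,M,N}`. -/
theorem completeGraph_isMinor_chimera (L M N : ℕ) (hL : 0 < L) (hM : 0 < M) (hN : 0 < N) :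
    IsMinor (⊤ : SimpleGraph (Fin (L * min M N))) (chimera L M N) := by
  let e : Fin (L * min M N) ≃ Fin L × Fin (min M N) := finProdFinEquiv.symm
  let row (u) : Fin M := (e u).2.castLE (min_le_left M N)
  let col (u) : Fin N := (e u).2.castLE (min_le_right M N)
  refine ⟨fun u => chimeraCross (row u) (col u) (e u).1, fun u => ⟨_, .inl ⟨row u, rfl⟩⟩,
    fun u v huv => ?_, fun u => chimeraCross_connected _ _ _, fun u v _ =>
      ⟨_, .inl ⟨row v, rfl⟩, _, .inr ⟨col u, rfl⟩, chimera_adj_cell _ _ _ _⟩⟩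
  have hne : e u ≠ e v := e.injective.ne huv
  apply chimeraCross_disjoint <;> contrapose! hne <;>
    simp only [row, col, Prod.mk.injEq, Fin.castLE_inj] at hne <;>
    exact Prod.ext hne.2 hne.1
end

section
/- For all positive integers L, M, N, the complete graph K_{L·min(M,N)+1} is a minor of the Chimera graph C_{L,M,N}. -/
namespace SimpleGraph

variable {V W : Type*} {G : SimpleGraph V} {H : SimpleGraph W}

theorem Connected.induce_range (hG : G.Connected) (f : G →g H) :
    (H.induce (Set.range f)).Connected := by
  refine hG.map (H := H.induce (Set.range f))
    ⟨fun v => ⟨f v, Set.mem_range_self v⟩, fun h => f.map_adj h⟩ ?_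
  rintro ⟨_, v, rfl⟩
  exact ⟨v, rfl⟩

/-- A system of `m + m` branch sets exhibiting `K_{m,m}` as a minor yields a `K_{m+1}` minor:
the `k`-th branch set is `A k ∪ B (k - 1)`, with the missing pieces at both ends omitted. -/
theorem isMinor_completeGraph_succ {m : ℕ} (hm : 0 < m) (A B : Fin m → Set W)
    (hA : ∀ i, (H.induce (A i)).Connected) (hB : ∀ i, (H.induce (B i)).Connected)
    (hAA : Pairwise fun i j => Disjoint (A i) (A j))
    (hBB : Pairwise fun i j => Disjoint (B i) (B j))
    (hAB : ∀ i j, Disjoint (A i) (B j))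
    (hadj : ∀ i j, ∃ a ∈ A i, ∃ b ∈ B j, H.Adj a b) :
    IsMinor (⊤ : SimpleGraph (Fin (m + 1))) H := by
  let φ : Fin (m + 1) → Set W := fun k =>
    {x | (∃ i, Fin.castSucc i = k ∧ x ∈ A i) ∨ ∃ j, Fin.succ j = k ∧ x ∈ B j}
  have hφA (i : Fin m) : A i ⊆ φ i.castSucc := fun x hx => .inl ⟨i, rfl, hx⟩
  have hφB (j : Fin m) : B j ⊆ φ j.succ := fun x hx => .inr ⟨j, rfl, hx⟩
  have hconn (k : Fin (m + 1)) : (H.induce (φ k)).Connected := by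
    by_cases hl : ∃ i : Fin m, i.castSucc = k
    · obtain ⟨i, rfl⟩ := hl
      by_cases h0 : ∃ j : Fin m, j.succ = i.castSucc
      · obtain ⟨j, hj⟩ := h0
        have : φ i.castSucc = A i ∪ B j := by
          ext x
          change (_ ∨ ∃ j, _) ↔ _
          simp only [← hj, Fin.succ_inj, exists_eq_left]
          simp [hj]
        rw [this]
        obtain ⟨a, ha, b, hb, hab⟩ := hadj i j
        exact connected_induce_union (hA i).preconnected (hB j).preconnected ha hb hab
      · have : φ i.castSucc = A i := by
          ext x
          have h0' (j : Fin m) : j.succ ≠ i.castSucc := fun h => h0 ⟨j, h⟩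
          simp [φ, h0']
        rw [this]
        exact hA i
    · obtain ⟨j, rfl⟩ : ∃ j : Fin m, j.succ = k := by
        refine Fin.exists_succ_eq.2 ?_
        rintro rfl
        exact hl ⟨⟨0, hm⟩, rfl⟩
      have : φ j.succ = B j := by
        ext x
        have hl' (i : Fin m) : i.castSucc ≠ j.succ := fun h => hl ⟨i, h⟩
        simp [φ, hl']
      rw [this]
      exact hB j
  have hlt {u v : Fin (m + 1)} (huv : u < v) : ∃ a ∈ φ u, ∃ b ∈ φ v, H.Adj a b := by
    obtain ⟨i, rfl⟩ := Fin.exists_castSucc_eq.2 (huv.trans_le (Fin.le_last v)).ne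
    obtain ⟨j, rfl⟩ := Fin.exists_succ_eq.2 ((Fin.zero_le _).trans_lt huv).ne'
    obtain ⟨a, ha, b, hb, hab⟩ := hadj i j
    exact ⟨a, hφA i ha, b, hφB j hb, hab⟩
  refine ⟨φ, fun u => Set.nonempty_coe_sort.1 (hconn u).nonempty, ?_, hconn, ?_⟩
  · intro u v huv
    rw [Set.disjoint_left]
    rintro x (⟨i, rfl, hi⟩ | ⟨i, rfl, hi⟩) (⟨j, rfl, hj⟩ | ⟨j, rfl, hj⟩)
    · exact Set.disjoint_left.1 (hAA fun h => huv (congrArg _ h)) hi hj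
    · exact Set.disjoint_left.1 (hAB i j) hi hj
    · exact Set.disjoint_left.1 (hAB j i) hj hi
    · exact Set.disjoint_left.1 (hBB fun h => huv (congrArg _ h)) hi hj
  · intro u v huv
    rcases huv.ne.lt_or_gt with h | h
    · exact hlt h
    · obtain ⟨a, ha, b, hb, hab⟩ := hlt h
      exact ⟨b, hb, a, ha, hab.symm⟩

end SimpleGraph

namespace Chimera

variable {L M N : ℕ}

/-- The column of vertical qubits in column `q.1` at height `q.2`. -/
def columnHom (q : Fin N × Fin L) : SimpleGraph.pathGraph M →g chimera L M N where
  toFun r := (r, q.1, 0, q.2)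
  map_rel' {r s} h := by
    have hne := h.ne
    rw [SimpleGraph.pathGraph_adj] at h
    simp [chimera, hne, h, or_comm]

/-- The row of horizontal qubits in row `q.1` at height `q.2`. -/
def rowHom (q : Fin M × Fin L) : SimpleGraph.pathGraph N →g chimera L M N where
  toFun c := (q.1, c, 1, q.2)
  map_rel' {c d} h := by
    have hne := h.ne
    rw [SimpleGraph.pathGraph_adj] at h
    simp [chimera, hne, h, or_comm]

@[simp]
theorem columnHom_apply (q : Fin N × Fin L) (r : Fin M) : columnHom q r = (r, q.1, 0, q.2) := rfl

@[simp]
theorem rowHom_apply (q : Fin M × Fin L) (c : Fin N) : rowHom q c = (q.1, c, 1, q.2) := rfl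

theorem connected_pathGraph {n : ℕ} (hn : 0 < n) : (SimpleGraph.pathGraph n).Connected := by
  obtain ⟨k, rfl⟩ := Nat.exists_eq_succ_of_ne_zero hn.ne'
  exact SimpleGraph.pathGraph_connected k

theorem disjoint_range_columnHom {p q : Fin N × Fin L} (h : p ≠ q) :
    Disjoint (Set.range (columnHom (M := M) p)) (Set.range (columnHom (M := M) q)) := by
  rw [Set.disjoint_left]
  rintro _ ⟨r, rfl⟩ ⟨s, hs⟩
  simp only [columnHom_apply, Prod.mk.injEq] at hs
  exact h (Prod.ext hs.2.1.symm hs.2.2.2.symm)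

theorem disjoint_range_rowHom {p q : Fin M × Fin L} (h : p ≠ q) :
    Disjoint (Set.range (rowHom (N := N) p)) (Set.range (rowHom (N := N) q)) := by
  rw [Set.disjoint_left]
  rintro _ ⟨r, rfl⟩ ⟨s, hs⟩
  simp only [rowHom_apply, Prod.mk.injEq] at hs
  exact h (Prod.ext hs.1.symm hs.2.2.2.symm)

theorem disjoint_range_rowHom_columnHom (p : Fin M × Fin L) (q : Fin N × Fin L) :
    Disjoint (Set.range (rowHom (N := N) p)) (Set.range (columnHom (M := M) q)) := by
  rw [Set.disjoint_left]
  rintro _ ⟨r, rfl⟩ ⟨s, hs⟩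
  simp at hs

theorem adj_rowHom_columnHom (p : Fin M × Fin L) (q : Fin N × Fin L) :
    (chimera L M N).Adj (rowHom p q.1) (columnHom q p.1) := by
  rw [rowHom_apply, columnHom_apply]
  simp [chimera]

end Chimera

/-- For all positive integers `L, M, N`, the complete graph `K_{L·min(M,N)+1}` is a
minor of the Chimera graph `C_{L,M,N}`. -/
theorem completeGraph_succ_isMinor_chimera (L M N : ℕ) (hL : 0 < L) (hM : 0 < M) (hN : 0 < N) :
    IsMinor (⊤ : SimpleGraph (Fin (L * min M N + 1))) (chimera L M N) := by
  have embed (K : ℕ) (hK : min M N ≤ K) : Nonempty (Fin (L * min M N) ↪ Fin K × Fin L) := by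
    apply Function.Embedding.nonempty_of_card_le
    simpa [mul_comm K] using Nat.mul_le_mul_left L hK
  obtain ⟨f⟩ := embed M (min_le_left M N)
  obtain ⟨g⟩ := embed N (min_le_right M N)
  exact SimpleGraph.isMinor_completeGraph_succ (Nat.mul_pos hL (lt_min hM hN))
    (fun i => Set.range (Chimera.rowHom (f i))) (fun j => Set.range (Chimera.columnHom (g j)))
    (fun i => (Chimera.connected_pathGraph hN).induce_range _)
    (fun j => (Chimera.connected_pathGraph hM).induce_range _)
    (fun _ _ h => Chimera.disjoint_range_rowHom (f.injective.ne h))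
    (fun _ _ h => Chimera.disjoint_range_columnHom (g.injective.ne h))
    (fun i j => Chimera.disjoint_range_rowHom_columnHom (f i) (g j))
    fun i j => ⟨_, Set.mem_range_self _, _, Set.mem_range_self _,
      Chimera.adj_rowHom_columnHom (f i) (g j)⟩
end

section
/- Let G be a finite simple graph whose vertex set is partitioned into three disjoint sets S, A, B such that A is an independent set of G and B is an independent set of G (no restriction is placed on edges incident to S or on edges between A and B). Then G is a minor of the complete bipartite graph K_{|S|+|A|, |S|+|B|}. -/
/-- If `p : W → V` is surjective, each of its fibers is a clique of `H`, and every edge of `G`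
lifts along `p` to an edge of `H`, then `G` is a minor of `H`. -/
theorem IsMinor.of_fibers {V W : Type*} {G : SimpleGraph V} {H : SimpleGraph W} (p : W → V)
    (hp : Function.Surjective p)
    (hclique : ∀ x y, p x = p y → x ≠ y → H.Adj x y)
    (hadj : ∀ u v, G.Adj u v → ∃ x y, p x = u ∧ p y = v ∧ H.Adj x y) :
    IsMinor G H := by
  refine ⟨fun u => p ⁻¹' {u}, fun u => hp u, fun u v huv => ?_, fun u => ?_, fun u v h => ?_⟩
  · exact Disjoint.preimage p (Set.disjoint_singleton.2 huv)
  · obtain ⟨w, hw⟩ := hp u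
    have : Nonempty (p ⁻¹' {u}) := ⟨⟨w, hw⟩⟩
    refine ⟨fun x y => ?_⟩
    by_cases hxy : x = y
    · rw [hxy]
    · exact SimpleGraph.Adj.reachable
        (hclique x y (x.2.trans y.2.symm) fun h => hxy (Subtype.ext h))
  · obtain ⟨x, y, hx, hy, hxy⟩ := hadj u v h
    exact ⟨x, hx, y, hy, hxy⟩

/-- If the vertex set of a finite graph `G` is partitioned into `S ∪ A ∪ B` with `A`
and `B` independent sets, then `G` is a minor of `K_{|S|+|A|, |S|+|B|}`. -/
theorem isMinor_completeBipartite_of_oct_decomposition {V : Type*} [Fintype V]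
    (G : SimpleGraph V) (S A B : Set V)
    (hSA : Disjoint S A) (hSB : Disjoint S B) (hAB : Disjoint A B)
    (hcover : S ∪ A ∪ B = Set.univ)
    (hA : ∀ u ∈ A, ∀ v ∈ A, ¬ G.Adj u v)
    (hB : ∀ u ∈ B, ∀ v ∈ B, ¬ G.Adj u v) :
    IsMinor G (completeBipartiteGraph (Fin (S.ncard + A.ncard)) (Fin (S.ncard + B.ncard))) := by
  have equivFin (T : Set V) (hT : Disjoint S T) :
      Nonempty (Fin (S.ncard + T.ncard) ≃ (S ∪ T : Set V)) := by
    rw [← Set.ncard_union_eq hT]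
    exact ⟨(Finite.equivFin _).symm⟩
  obtain ⟨e⟩ := equivFin A hSA
  obtain ⟨f⟩ := equivFin B hSB
  have he (u : V) (hu : u ∈ S ∪ A) : ∃ i, (e i : V) = u := ⟨e.symm ⟨u, hu⟩, by simp⟩
  have hf (u : V) (hu : u ∈ S ∪ B) : ∃ j, (f j : V) = u := ⟨f.symm ⟨u, hu⟩, by simp⟩
  have hmem (u : V) : u ∈ S ∨ u ∈ A ∨ u ∈ B := by
    simpa [or_assoc] using hcover.ge (Set.mem_univ u)
  refine IsMinor.of_fibers (Sum.elim (fun i => (e i : V)) fun j => (f j : V)) ?_ ?_ ?_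
  · intro u
    by_cases hu : u ∈ S ∪ A
    · obtain ⟨i, hi⟩ := he u hu
      exact ⟨.inl i, hi⟩
    · obtain ⟨j, hj⟩ := hf u (by grind)
      exact ⟨.inr j, hj⟩
  · rintro (i | i) (j | j) hij hne
    · exact (hne (congrArg _ (e.injective (Subtype.ext hij)))).elim
    · simp
    · simp
    · exact (hne (congrArg _ (f.injective (Subtype.ext hij)))).elim
  · intro u v huv
    have key : (u ∈ S ∪ A ∧ v ∈ S ∪ B) ∨ (u ∈ S ∪ B ∧ v ∈ S ∪ A) := by
      have := hA u
      have := hB u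
      grind
    rcases key with ⟨hu, hv⟩ | ⟨hu, hv⟩
    · obtain ⟨i, hi⟩ := he u hu
      obtain ⟨j, hj⟩ := hf v hv
      exact ⟨.inl i, .inr j, hi, hj, by simp⟩
    · obtain ⟨j, hj⟩ := hf u hu
      obtain ⟨i, hi⟩ := he v hv
      exact ⟨.inr j, .inl i, hj, hi, by simp⟩
end

section
/- Let H be a finite simple graph whose vertex set is partitioned into two disjoint sets X and Y such that the induced subgraph H[Y] is acyclic (a forest). If a finite simple graph G is a minor of H, then OCT(G) ≤ |X|. -/
/-- On a finite forest, every prescription of which edges are to be monochromatic is realized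
by some two-colouring of the vertices. -/
theorem SimpleGraph.IsAcyclic.exists_bool_coloring_eq_iff {V : Type*} [Finite V]
    {F : SimpleGraph V} (hF : F.IsAcyclic) (A : V → V → Prop) (hA : ∀ x y, A x y → A y x) :
    ∃ c : V → Bool, ∀ x y, F.Adj x y → (c x = c y ↔ A x y) := by
  classical
  induction F using WellFoundedLT.induction with
  | ind F ih =>
    by_cases hE : ∃ x y, F.Adj x y
    · obtain ⟨x, y, hxy⟩ := hE
      set F' := F.deleteEdges {s(x, y)} with hF'
      have hle : F' ≤ F := F.deleteEdges_le _
      have hlt : F' < F := by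
        refine hle.lt_of_ne fun h ↦ ?_
        have : F'.Adj x y := h ▸ hxy
        simp [hF'] at this
      have hbridge : ¬ F'.Reachable x y :=
        SimpleGraph.isAcyclic_iff_forall_isBridge.1 hF (F.mem_edgeSet.2 hxy)
      obtain ⟨c, hc⟩ := ih F' hlt (hF.anti hle)
      have hadj : ∀ a b, F.Adj a b → F'.Adj a b ∨ (a = x ∧ b = y) ∨ (a = y ∧ b = x) := by
        intro a b hab
        simp only [hF', SimpleGraph.deleteEdges_adj, Set.mem_singleton_iff, Sym2.eq_iff]
        tauto
      by_cases hgood : c x = c y ↔ A x y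
      · refine ⟨c, fun a b hab ↦ ?_⟩
        rcases hadj a b hab with h | ⟨rfl, rfl⟩ | ⟨rfl, rfl⟩
        · exact hc a b h
        · exact hgood
        · exact eq_comm.trans (hgood.trans ⟨hA _ _, hA _ _⟩)
      · let d : V → Bool := fun v ↦ if F'.Reachable x v then !c v else c v
        have hd : d x = d y ↔ A x y := by
          simp only [d, SimpleGraph.Reachable.refl, if_true, if_neg hbridge]
          cases hx : c x <;> cases hy : c y <;> simp_all
        refine ⟨d, fun a b hab ↦ ?_⟩
        rcases hadj a b hab with h | ⟨rfl, rfl⟩ | ⟨rfl, rfl⟩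
        · have hr : F'.Reachable x a ↔ F'.Reachable x b :=
            ⟨fun p ↦ p.trans h.reachable, fun p ↦ p.trans h.symm.reachable⟩
          rw [← hc a b h]
          by_cases hb : F'.Reachable x b
          · simp [d, hr, hb]
          · simp [d, hr, hb]
        · exact hd
        · exact eq_comm.trans (hd.trans ⟨hA _ _, hA _ _⟩)
    · exact ⟨fun _ ↦ true, fun x y h ↦ (hE ⟨x, y, h⟩).elim⟩

/-- A function that is constant along edges of a connected graph is constant. -/
theorem SimpleGraph.Connected.apply_eq_of_forall_adj {V α : Type*} {G : SimpleGraph V}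
    (hG : G.Connected) {f : V → α} (hf : ∀ x y, G.Adj x y → f x = f y) (x y : V) :
    f x = f y := by
  obtain ⟨p⟩ := hG.preconnected x y
  induction p with
  | nil => rfl
  | cons h _ ih => exact (hf _ _ h).trans ih

/-- If `G` is a minor of a finite graph `H` with branch sets `φ`, then the vertices of `G` whose
branch sets lie in a set `Y` inducing a forest in `H` induce a bipartite graph. -/
theorem SimpleGraph.IsAcyclic.colorable_two_of_branchSets_subset {V W : Type*} [Finite W]
    {G : SimpleGraph V} {H : SimpleGraph W} {Y : Set W} (hY : (H.induce Y).IsAcyclic)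
    {φ : V → Set W} (hne : ∀ u, (φ u).Nonempty)
    (hdisj : Pairwise fun u v => Disjoint (φ u) (φ v))
    (hconn : ∀ u, (H.induce (φ u)).Connected)
    (hadj : ∀ u v, G.Adj u v → ∃ u' ∈ φ u, ∃ v' ∈ φ v, H.Adj u' v')
    {T : Set V} (hT : ∀ u ∈ T, φ u ⊆ Y) : (G.induce T).Colorable 2 := by
  classical
  obtain ⟨c, hc⟩ := hY.exists_bool_coloring_eq_iff
    (fun x y ↦ ∃ u, x.1 ∈ φ u ∧ y.1 ∈ φ u) fun _ _ ⟨u, hx, hy⟩ ↦ ⟨u, hy, hx⟩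
  let d : W → Bool := fun w ↦ if h : w ∈ Y then c ⟨w, h⟩ else true
  have hd : ∀ x y, x ∈ Y → y ∈ Y → H.Adj x y →
      (d x = d y ↔ ∃ u, x ∈ φ u ∧ y ∈ φ u) := by
    intro x y hx hy hxy
    simpa only [d, dif_pos hx, dif_pos hy] using hc ⟨x, hx⟩ ⟨y, hy⟩ hxy
  have hconst : ∀ u ∈ T, ∀ x ∈ φ u, ∀ y ∈ φ u, d x = d y := by
    intro u hu x hx y hy
    exact (hconn u).apply_eq_of_forall_adj (f := fun w ↦ d w.1)
      (fun a b hab ↦ (hd a b (hT u hu a.2) (hT u hu b.2) hab).2 ⟨u, a.2, b.2⟩) ⟨x, hx⟩ ⟨y, hy⟩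
  choose r hr using hne
  let C : (G.induce T).Coloring Bool := SimpleGraph.Coloring.mk (fun u ↦ d (r u.1)) <| by
    rintro ⟨u, hu⟩ ⟨v, hv⟩ huv heq
    have huv' : G.Adj u v := huv
    obtain ⟨x, hx, y, hy, hxy⟩ := hadj u v huv'
    have hxy' : d x = d y :=
      (hconst u hu x hx _ (hr u)).trans (heq.trans (hconst v hv _ (hr v) y hy))
    obtain ⟨w, hxw, hyw⟩ := (hd x y (hT u hu hx) (hT v hv hy) hxy).1 hxy'
    have huw : u = w := hdisj.eq (Set.not_disjoint_iff.2 ⟨x, hx, hxw⟩)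
    have hvw : v = w := hdisj.eq (Set.not_disjoint_iff.2 ⟨y, hy, hyw⟩)
    exact huv'.ne (huw.trans hvw.symm)
  simpa using C.colorable

/-- If the vertex set of a finite graph `H` is partitioned into `X ∪ Y` with `H[Y]`
acyclic, and the finite graph `G` is a minor of `H`, then `OCT(G) ≤ |X|`. -/
theorem oct_le_of_minor_forest_decomposition {VH VG : Type*} [Fintype VH] [Fintype VG]
    (H : SimpleGraph VH) (G : SimpleGraph VG) (X Y : Set VH)
    (hdisj : Disjoint X Y) (hcover : X ∪ Y = Set.univ)
    (hforest : (H.induce Y).IsAcyclic)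
    (hminor : IsMinor G H) :
    octNum G ≤ X.ncard := by
  obtain ⟨φ, hne, hφ, hconn, hadj⟩ := hminor
  let S : Set VG := {u | (φ u ∩ X).Nonempty}
  have hS : ∀ u ∈ Sᶜ, φ u ⊆ Y := by
    intro u hu x hx
    have hxX : x ∉ X := fun h ↦ hu ⟨x, hx, h⟩
    exact (hcover ▸ Set.mem_univ x : x ∈ X ∪ Y).resolve_left hxX
  have hcol : (G.induce Sᶜ).Colorable 2 :=
    hforest.colorable_two_of_branchSets_subset hne hφ hconn hadj hS
  have hex : ∀ u, ∃ x, u ∈ S → x ∈ φ u ∩ X := fun u ↦ by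
    by_cases hu : u ∈ S
    · exact ⟨hu.some, fun _ ↦ hu.some_mem⟩
    · exact ⟨(hne u).some, fun h ↦ (hu h).elim⟩
  choose f hf using hex
  have hcard : S.ncard ≤ X.ncard := by
    refine Set.ncard_le_ncard_of_injOn f (fun u hu ↦ (hf u hu).2) ?_ X.toFinite
    intro u hu v hv huv
    exact hφ.eq (Set.not_disjoint_iff.2 ⟨f u, (hf u hu).1, huv ▸ (hf v hv).1⟩)
  have hoct : octNum G ≤ S.ncard := Nat.sInf_le ⟨S, rfl, hcol⟩
  exact hoct.trans hcard
end

section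
/- Let G be a finite simple graph on n vertices that contains a nonempty subgraph in which every vertex has degree at least d (equivalently, G has degeneracy at least d). Then every induced bipartite subgraph of G has at most 2(n − d) vertices; that is, every vertex set W ⊆ V(G) such that the induced subgraph G[W] is bipartite satisfies |W| ≤ 2(n − d). -/
/-- An independent set in a finite graph containing a nonempty subgraph of minimum degree at
least `d` misses at least `d` vertices. -/
theorem SimpleGraph.IsIndepSet.ncard_add_le_card {V : Type*} [Fintype V] {G : SimpleGraph V}
    {I U : Set V} {d : ℕ} (hI : G.IsIndepSet I) (hU : U.Nonempty)
    (hdeg : ∀ v ∈ U, d ≤ {u | u ∈ U ∧ G.Adj v u}.ncard) :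
    I.ncard + d ≤ Fintype.card V := by
  obtain ⟨v, hv, hdisj⟩ : ∃ v ∈ U, Disjoint I {u | u ∈ U ∧ G.Adj v u} := by
    by_cases h : ∃ v ∈ U, v ∈ I
    · obtain ⟨v, hv, hvI⟩ := h
      exact ⟨v, hv, Set.disjoint_left.2 fun u hu hvu => hI hvI hu hvu.2.ne hvu.2⟩
    · obtain ⟨v, hv⟩ := hU
      exact ⟨v, hv, Set.disjoint_left.2 fun u hu hvu => h ⟨u, hvu.1, hu⟩⟩
  calc I.ncard + d ≤ I.ncard + {u | u ∈ U ∧ G.Adj v u}.ncard := by gcongr; exact hdeg v hv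
    _ = (I ∪ {u | u ∈ U ∧ G.Adj v u}).ncard := (Set.ncard_union_eq hdisj).symm
    _ ≤ Fintype.card V := by
      rw [← Nat.card_eq_fintype_card]
      exact Set.ncard_le_card _

/-- If a finite graph `G` on `n` vertices contains a nonempty subgraph in which every
vertex has degree at least `d`, then every induced bipartite subgraph of `G` has at most
`2(n − d)` vertices. -/
theorem bipartite_subgraph_card_le_of_degeneracy {V : Type*} [Fintype V]
    (G : SimpleGraph V) (n d : ℕ) (hn : Fintype.card V = n)
    (hdeg : ∃ U : Set V, U.Nonempty ∧ ∀ v ∈ U, d ≤ {u | u ∈ U ∧ G.Adj v u}.ncard)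
    (W : Set V) (hW : (G.induce W).Colorable 2) :
    W.ncard ≤ 2 * (n - d) := by
  obtain ⟨U, hU, hdeg⟩ := hdeg
  obtain ⟨C⟩ := hW
  have hclass (i : Fin 2) : (Subtype.val '' C.colorClass i).ncard + d ≤ n := by
    refine hn ▸ SimpleGraph.IsIndepSet.ncard_add_le_card (G := G) ?_ hU hdeg
    rintro _ ⟨a, ha, rfl⟩ _ ⟨b, hb, rfl⟩ - hab
    exact C.valid (v := a) (w := b) hab (Eq.trans ha (Eq.symm hb))
  have hcover : W ⊆ Subtype.val '' C.colorClass 0 ∪ Subtype.val '' C.colorClass 1 := by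
    intro w hw
    rcases Fin.exists_fin_two.1 ⟨C ⟨w, hw⟩, rfl⟩ with h | h
    · exact Or.inl ⟨⟨w, hw⟩, h, rfl⟩
    · exact Or.inr ⟨⟨w, hw⟩, h, rfl⟩
  have hle := (Set.ncard_le_ncard hcover).trans (Set.ncard_union_le _ _)
  have h0 := hclass 0
  have h1 := hclass 1
  omega
end
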